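/- Let α be a 2-form on ℝ⁷ with ⋆(α∧ω) = α. Then 4·α_{ai}α_{bi}α_{aj}α_{bj} = ‖α‖⁴ (summing over a,b,i,j), where ‖α‖² = α_{ij}α_{ij}. -/

import Mathlib

open scoped BigOperators

/-- The generalized Kronecker/Levi-Civita epsilon symbol on `Fin 7`. -/
noncomputable def eps (v : Fin 7 → Fin 7) : ℝ :=
  if h : Function.Bijective v then ((Equiv.Perm.sign (Equiv.ofBijective v h) : ℤ) : ℝ) else 0

/-- The basis monomial form `e_{I 0} ∧ ⋯ ∧ e_{I (p-1)}`, given by its components. -/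
noncomputable def mono {p : ℕ} (I : Fin p → Fin 7) : (Fin p → Fin 7) → ℝ :=
  fun v => Matrix.det (Matrix.of fun a b => if I a = v b then (1 : ℝ) else 0)

/-- A (componentwise) `p`-form: totally antisymmetric in its indices. -/
def IsForm {p : ℕ} (c : (Fin p → Fin 7) → ℝ) : Prop :=
  (∀ v : Fin p → Fin 7, ¬ Function.Injective v → c v = 0) ∧
  (∀ (v : Fin p → Fin 7) (σ : Equiv.Perm (Fin p)),
    c (v ∘ σ) = ((Equiv.Perm.sign σ : ℤ) : ℝ) * c v)

/-- Wedge product of forms, in components. -/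
noncomputable def wedge {p q : ℕ} (a : (Fin p → Fin 7) → ℝ) (b : (Fin q → Fin 7) → ℝ) :
    (Fin (p + q) → Fin 7) → ℝ := fun v =>
  (1 / ((Nat.factorial p : ℝ) * (Nat.factorial q : ℝ))) *
    ∑ σ : Equiv.Perm (Fin (p + q)),
      ((Equiv.Perm.sign σ : ℤ) : ℝ) *
        a (fun i => v (σ (Fin.castAdd q i))) * b (fun j => v (σ (Fin.natAdd p j)))

/-- The Hodge star operator (standard metric and orientation on ℝ⁷), in components. -/
noncomputable def hstar {p q : ℕ} (h : p + q = 7) (a : (Fin p → Fin 7) → ℝ) :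
    (Fin q → Fin 7) → ℝ := fun w =>
  (1 / (Nat.factorial p : ℝ)) *
    ∑ v : Fin p → Fin 7, a v * eps (fun i => Fin.append v w (Fin.cast h.symm i))

/-- The fundamental 3-form ω = e₁₂₄+e₂₃₅+e₃₄₆+e₄₅₇+e₅₆₁+e₆₇₂+e₇₁₃ (indices shifted to 0,…,6). -/
noncomputable def ω : (Fin 3 → Fin 7) → ℝ :=
  mono ![0, 1, 3] + mono ![1, 2, 4] + mono ![2, 3, 5] + mono ![3, 4, 6] +
    mono ![4, 5, 0] + mono ![5, 6, 1] + mono ![6, 0, 2]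

/-- The 4-form Φ = −e₃₅₆₇−e₄₆₇₁−e₅₇₁₂−e₆₁₂₃−e₇₂₃₄−e₁₃₄₅−e₂₄₅₆ (indices shifted to 0,…,6). -/
noncomputable def Φ : (Fin 4 → Fin 7) → ℝ :=
  -mono ![2, 4, 5, 6] - mono ![3, 5, 6, 0] - mono ![4, 6, 0, 1] - mono ![5, 0, 1, 2] -
    mono ![6, 1, 2, 3] - mono ![0, 2, 3, 4] - mono ![1, 3, 4, 5]

/-- Components ω_{ijk}. -/
noncomputable def ω3 (i j k : Fin 7) : ℝ := ω ![i, j, k]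

/-- Components ω_{ijkl} = Φ(e_i,e_j,e_k,e_l). -/
noncomputable def ω4 (i j k l : Fin 7) : ℝ := Φ ![i, j, k, l]

/-- Kronecker delta. -/
def δ (i j : Fin 7) : ℝ := if i = j then 1 else 0

/-- Components of a 2-form. -/
def c2 (a : (Fin 2 → Fin 7) → ℝ) (i j : Fin 7) : ℝ := a ![i, j]

/-- The operator α ↦ ⋆(α ∧ ω) on 2-forms. -/
noncomputable def Lω (a : (Fin 2 → Fin 7) → ℝ) : (Fin 2 → Fin 7) → ℝ :=
  hstar (p := 5) (q := 2) rfl (wedge a ω)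

theorem eps_comp_perm (v : Fin 7 → Fin 7) (σ : Equiv.Perm (Fin 7)) :
    eps (v ∘ σ) = ((Equiv.Perm.sign σ : ℤ) : ℝ) * eps v := by
  unfold eps
  by_cases h : Function.Bijective v
  · have h' : Function.Bijective (v ∘ σ) := h.comp σ.bijective
    have e : Equiv.ofBijective (v ∘ σ) h' = Equiv.ofBijective v h * σ := by
      ext i; rfl
    rw [dif_pos h, dif_pos h', e, Equiv.Perm.sign_mul]
    push_cast
    ring
  · have h' : ¬ Function.Bijective (v ∘ σ) := by
      rwa [Function.Bijective.of_comp_iff v σ.bijective]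
    rw [dif_neg h, dif_neg h', mul_zero]

/-- A computable integer-valued version of `eps`. -/
def epsInt (v : Fin 7 → Fin 7) : ℤ :=
  ∏ i, ∏ j ∈ Finset.Ioi i, if v i < v j then 1 else if v i = v j then 0 else -1

theorem eps_eq_epsInt (v : Fin 7 → Fin 7) : eps v = epsInt v := by
  unfold eps epsInt
  split_ifs with h
  · rw [Equiv.Perm.sign_eq_prod_prod_Ioi]
    push_cast
    refine Finset.prod_congr rfl fun i _ => Finset.prod_congr rfl fun j hj => ?_
    have hij : v i ≠ v j := fun e => (Finset.mem_Ioi.1 hj).ne (h.1 e)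
    simp only [Equiv.ofBijective_apply]
    split_ifs <;> simp_all
  · have hinj : ¬ Function.Injective v := fun hi => h (Finite.injective_iff_bijective.1 hi)
    obtain ⟨i, j, hv, hne⟩ : ∃ i j, v i = v j ∧ i ≠ j := by
      simpa [Function.Injective] using hinj
    wlog hij : i < j generalizing i j
    · exact this j i hv.symm hne.symm (lt_of_le_of_ne (not_lt.1 hij) hne.symm)
    rw [eq_comm, Int.cast_eq_zero]
    refine Finset.prod_eq_zero (Finset.mem_univ i)
      (Finset.prod_eq_zero (Finset.mem_Ioi.2 hij) ?_)
    simp [hv]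

/-- Contracting a basis monomial with an alternating array evaluates the array. -/
theorem sum_mono_mul {q : ℕ} (I : Fin q → Fin 7) (g : (Fin q → Fin 7) → ℝ)
    (hg : ∀ (v : Fin q → Fin 7) (σ : Equiv.Perm (Fin q)),
      g (v ∘ σ) = ((Equiv.Perm.sign σ : ℤ) : ℝ) * g v) :
    ∑ t, mono I t * g t = (Nat.factorial q : ℝ) * g I := by
  have hmono (t : Fin q → Fin 7) : mono I t =
      ∑ τ : Equiv.Perm (Fin q), ((Equiv.Perm.sign τ : ℤ) : ℝ) * if I ∘ τ = t then 1 else 0 := by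
    unfold mono
    rw [Matrix.det_apply']
    refine Finset.sum_congr rfl fun τ _ => ?_
    congr 1
    simp only [Matrix.of_apply, Finset.prod_ite_zero, Finset.prod_const_one, funext_iff,
      Function.comp_apply, Finset.mem_univ, true_imp_iff]
  simp_rw [hmono, Finset.sum_mul]
  rw [Finset.sum_comm]
  have hτ (τ : Equiv.Perm (Fin q)) :
      ∑ t, ((Equiv.Perm.sign τ : ℤ) : ℝ) * (if I ∘ τ = t then 1 else 0) * g t = g I := by
    simp only [mul_ite, mul_one, mul_zero, ite_mul, zero_mul, Finset.sum_ite_eq,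
      Finset.mem_univ, if_true]
    rw [hg, ← mul_assoc, ← Int.cast_mul]
    simp
  rw [Finset.sum_congr rfl fun τ _ => hτ τ]
  simp [Fintype.card_perm]

theorem eps_append_comp_perm {n r : ℕ} (h : n + r = 7) (v : Fin n → Fin 7) (w : Fin r → Fin 7)
    (σ : Equiv.Perm (Fin n)) :
    eps (fun i => Fin.append (v ∘ σ) w (Fin.cast h.symm i)) =
      ((Equiv.Perm.sign σ : ℤ) : ℝ) * eps (fun i => Fin.append v w (Fin.cast h.symm i)) := by
  let e : Fin n ⊕ Fin r ≃ Fin 7 := finSumFinEquiv.trans (finCongr h)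
  let τ : Equiv.Perm (Fin 7) := e.permCongr (Equiv.Perm.sumCongr σ 1)
  have hτ : Equiv.Perm.sign τ = Equiv.Perm.sign σ := by
    simp [τ, Equiv.Perm.sign_permCongr, Equiv.Perm.sign_sumCongr]
  rw [← hτ, ← eps_comp_perm]
  congr 1
  funext i
  obtain ⟨x, rfl⟩ := e.surjective i
  rcases x with x | x <;> simp [τ, e, Equiv.permCongr_apply]

theorem append_comp_perm_right {p q : ℕ} {β : Type*} (u : Fin p → β) (t : Fin q → β)
    (σ : Equiv.Perm (Fin q)) :
    Fin.append u (t ∘ σ) = Fin.append u t ∘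
      finSumFinEquiv.permCongr (Equiv.Perm.sumCongr (1 : Equiv.Perm (Fin p)) σ) := by
  funext k
  obtain ⟨x, rfl⟩ := finSumFinEquiv.surjective k
  rcases x with x | x <;> simp [Equiv.permCongr_apply]

theorem hstar_wedge {p q r : ℕ} (h : p + q + r = 7) (a : (Fin p → Fin 7) → ℝ)
    (b : (Fin q → Fin 7) → ℝ) (w : Fin r → Fin 7) :
    hstar h (wedge a b) w = (1 / ((Nat.factorial p : ℝ) * (Nat.factorial q : ℝ))) *
      ∑ u : Fin p → Fin 7, a u * ∑ t : Fin q → Fin 7,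
        b t * eps (fun i => Fin.append (Fin.append u t) w (Fin.cast h.symm i)) := by
  let F : (Fin (p + q) → Fin 7) → ℝ := fun v =>
    a (fun i => v (Fin.castAdd q i)) * b (fun j => v (Fin.natAdd p j)) *
      eps (fun i => Fin.append v w (Fin.cast h.symm i))
  have hsum (σ : Equiv.Perm (Fin (p + q))) : ∑ v, F (v ∘ σ) = ∑ v, F v :=
    Equiv.sum_comp (σ.symm.arrowCongr (Equiv.refl (Fin 7))) F
  have hF : ∑ v, F v = ∑ u : Fin p → Fin 7, a u * ∑ t : Fin q → Fin 7,
      b t * eps (fun i => Fin.append (Fin.append u t) w (Fin.cast h.symm i)) := by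
    rw [← Equiv.sum_comp (Fin.appendEquiv p q), Fintype.sum_prod_type]
    refine Finset.sum_congr rfl fun u _ => ?_
    rw [Finset.mul_sum]
    refine Finset.sum_congr rfl fun t _ => ?_
    simp [F, Fin.appendEquiv, mul_assoc]
  have hterm (v : Fin (p + q) → Fin 7) :
      wedge a b v * eps (fun i => Fin.append v w (Fin.cast h.symm i)) =
        (1 / ((Nat.factorial p : ℝ) * (Nat.factorial q : ℝ))) *
          ∑ σ : Equiv.Perm (Fin (p + q)), F (v ∘ σ) := by
    unfold wedge
    rw [mul_assoc, Finset.sum_mul]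
    congr 1
    refine Finset.sum_congr rfl fun σ _ => ?_
    simp only [F, eps_append_comp_perm h v w σ, Function.comp_apply]
    ring
  have hfact : ((Nat.factorial (p + q) : ℕ) : ℝ) ≠ 0 := by positivity
  unfold hstar
  simp_rw [hterm]
  rw [← Finset.mul_sum, Finset.sum_comm]
  simp_rw [hsum]
  rw [hF, Finset.sum_const, Finset.card_univ, Fintype.card_perm, Fintype.card_fin, nsmul_eq_mul]
  field_simp

theorem ω_eq_sum : ω = ∑ m : Fin 7, mono ![m, m + 1, m + 3] := by
  rw [Fin.sum_univ_seven]
  rfl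

/-- The components of `⋆ω`. -/
def starω (a b i j : Fin 7) : ℤ := ∑ m : Fin 7, epsInt ![a, b, m, m + 1, m + 3, i, j]

theorem c2_Lω (α : (Fin 2 → Fin 7) → ℝ) (i j : Fin 7) :
    c2 (Lω α) i j = 1 / 2 * ∑ a, ∑ b, c2 α a b * starω a b i j := by
  have hinner (u : Fin 2 → Fin 7) : ∑ t : Fin 3 → Fin 7, ω t *
      eps (fun k => Fin.append (Fin.append u t) ![i, j] (Fin.cast rfl k)) =
        6 * starω (u 0) (u 1) i j := by
    rw [ω_eq_sum]
    simp only [Finset.sum_apply, Finset.sum_mul]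
    rw [Finset.sum_comm, starω, Int.cast_sum, Finset.mul_sum]
    refine Finset.sum_congr rfl fun m _ => ?_
    rw [sum_mono_mul ![m, m + 1, m + 3]
      (fun t => eps (fun k => Fin.append (Fin.append u t) ![i, j] (Fin.cast rfl k))), eps_eq_epsInt]
    · congr 3
      funext k
      fin_cases k <;> rfl
    · intro t σ
      have := eps_append_comp_perm (n := 5) (r := 2) rfl (Fin.append u t) ![i, j]
        (finSumFinEquiv.permCongr (Equiv.Perm.sumCongr (1 : Equiv.Perm (Fin 2)) σ))
      rw [← append_comp_perm_right, Equiv.Perm.sign_permCongr, Equiv.Perm.sign_sumCongr] at this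
      simpa using this
  have hstar_eq := hstar_wedge (p := 2) (q := 3) (r := 2) rfl α ω ![i, j]
  unfold c2 Lω
  rw [hstar_eq]
  simp_rw [hinner]
  rw [← Equiv.sum_comp (finTwoArrowEquiv (Fin 7)).symm, Fintype.sum_prod_type]
  simp only [finTwoArrowEquiv_symm_apply, Finset.mul_sum]
  refine Finset.sum_congr rfl fun a _ => Finset.sum_congr rfl fun b _ => ?_
  norm_num [Nat.factorial]
  ring

theorem starω_succ (m a b : Fin 7) : starω (m + a) (m + b) (m + 1) (m + 3) =
    (if a = 6 ∧ b = 2 then 1 else 0) - (if a = 2 ∧ b = 6 then 1 else 0) +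
    (if a = 5 ∧ b = 4 then 1 else 0) - (if a = 4 ∧ b = 5 then 1 else 0) := by
  revert m a b
  decide +kernel

theorem IsForm.c2_swap {α : (Fin 2 → Fin 7) → ℝ} (hα : IsForm α) (i j : Fin 7) :
    c2 α j i = -c2 α i j := by
  have h := hα.2 ![i, j] (Equiv.swap 0 1)
  have e : ![i, j] ∘ Equiv.swap (0 : Fin 2) 1 = ![j, i] := by
    funext k
    fin_cases k <;> simp
  rw [e, Equiv.Perm.sign_swap (by decide)] at h
  simpa [c2] using h

/-- A 2-form fixed by `Lω` has vanishing contraction with `ω`. -/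
theorem contraction_eq_zero {α : (Fin 2 → Fin 7) → ℝ} (hα : IsForm α) (h14 : Lω α = α)
    (m : Fin 7) :
    c2 α (m + 1) (m + 3) + c2 α (m + 2) (m + 6) + c2 α (m + 4) (m + 5) = 0 := by
  have h := c2_Lω α (m + 1) (m + 3)
  rw [h14, ← Equiv.sum_comp (Equiv.addLeft m)] at h
  have hb (a : Fin 7) := (Equiv.sum_comp (Equiv.addLeft m)
    (fun b => c2 α (m + a) b * starω (m + a) b (m + 1) (m + 3))).symm
  simp only [Equiv.coe_addLeft] at h hb
  simp only [hb, starω_succ] at h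
  push_cast at h
  simp only [mul_add, mul_sub, ite_and, mul_ite, mul_one, mul_zero, Finset.sum_add_distrib,
    Finset.sum_sub_distrib, Finset.sum_ite_eq', Finset.sum_ite_irrel, Finset.sum_const_zero,
    Finset.mem_univ, if_true] at h
  rw [hα.c2_swap (m + 2) (m + 6), hα.c2_swap (m + 4) (m + 5)] at h
  linarith

/-- for α ∈ Λ²₁₄, 4·α_{ai}α_{bi}α_{aj}α_{bj} = ‖α‖⁴. -/
theorem lambda14_norm_fourth (α : (Fin 2 → Fin 7) → ℝ) (hα : IsForm α) (h14 : Lω α = α) :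
    4 * (∑ a : Fin 7, ∑ b : Fin 7, ∑ i : Fin 7, ∑ j : Fin 7,
        c2 α a i * c2 α b i * c2 α a j * c2 α b j) =
      (∑ i : Fin 7, ∑ j : Fin 7, c2 α i j * c2 α i j) ^ 2 := by
  have hdiag (i : Fin 7) : c2 α i i = 0 := by linarith [hα.c2_swap i i]
  have hM : ∑ a : Fin 7, ∑ b : Fin 7, ∑ i : Fin 7, ∑ j : Fin 7,
      c2 α a i * c2 α b i * c2 α a j * c2 α b j =
        ∑ a : Fin 7, ∑ b : Fin 7, (∑ i : Fin 7, c2 α a i * c2 α b i) ^ 2 := by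
    refine Finset.sum_congr rfl fun a _ => Finset.sum_congr rfl fun b _ => ?_
    rw [sq, Finset.sum_mul_sum]
    refine Finset.sum_congr rfl fun i _ => Finset.sum_congr rfl fun j _ => ?_
    ring
  have h0 : c2 α 1 3 = -c2 α 2 6 - c2 α 4 5 := by
    have h : c2 α 1 3 + c2 α 2 6 + c2 α 4 5 = 0 := contraction_eq_zero hα h14 0
    linarith
  have h1 : c2 α 2 4 = c2 α 0 3 - c2 α 5 6 := by
    have h : c2 α 2 4 + c2 α 3 0 + c2 α 5 6 = 0 := contraction_eq_zero hα h14 1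
    linarith [hα.c2_swap 0 3]
  have h2 : c2 α 3 5 = c2 α 1 4 + c2 α 0 6 := by
    have h : c2 α 3 5 + c2 α 4 1 + c2 α 6 0 = 0 := contraction_eq_zero hα h14 2
    linarith [hα.c2_swap 1 4, hα.c2_swap 0 6]
  have h3 : c2 α 4 6 = c2 α 2 5 - c2 α 0 1 := by
    have h : c2 α 4 6 + c2 α 5 2 + c2 α 0 1 = 0 := contraction_eq_zero hα h14 3
    linarith [hα.c2_swap 2 5]
  have h4 : c2 α 0 5 = -c2 α 3 6 + c2 α 1 2 := by
    have h : c2 α 5 0 + c2 α 6 3 + c2 α 1 2 = 0 := contraction_eq_zero hα h14 4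
    linarith [hα.c2_swap 0 5, hα.c2_swap 3 6]
  have h5 : c2 α 1 6 = c2 α 0 4 + c2 α 2 3 := by
    have h : c2 α 6 1 + c2 α 0 4 + c2 α 2 3 = 0 := contraction_eq_zero hα h14 5
    linarith [hα.c2_swap 1 6]
  have h6 : c2 α 0 2 = -c2 α 1 5 - c2 α 3 4 := by
    have h : c2 α 0 2 + c2 α 1 5 + c2 α 3 4 = 0 := contraction_eq_zero hα h14 6
    linarith
  rw [hM]
  simp only [Fin.sum_univ_seven, hdiag,
    hα.c2_swap 0 1, hα.c2_swap 0 2, hα.c2_swap 0 3, hα.c2_swap 0 4, hα.c2_swap 0 5, hα.c2_swap 0 6,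
    hα.c2_swap 1 2, hα.c2_swap 1 3, hα.c2_swap 1 4, hα.c2_swap 1 5, hα.c2_swap 1 6, hα.c2_swap 2 3,
    hα.c2_swap 2 4, hα.c2_swap 2 5, hα.c2_swap 2 6, hα.c2_swap 3 4, hα.c2_swap 3 5, hα.c2_swap 3 6,
    hα.c2_swap 4 5, hα.c2_swap 4 6, hα.c2_swap 5 6,
    h0, h1, h2, h3, h4, h5, h6]
  ring
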